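/- Let q be a prime power and let d, k be positive integers with d ≤ q and d ≥ 2k + 1. Then, over any field F, the dimension of the F-linear span of the set ∂^k(NW_{q,d,k}) of k-th order partial derivatives of NW_{q,d,k} is at least C(d,k)·q^k. -/

import Mathlib

open MvPolynomial

/-- The iterated partial derivative operator `∂_m` associated to the exponent vector `m`. -/
noncomputable def iterDeriv {σv F : Type*} [CommRing F] (m : σv →₀ ℕ) :
    Module.End F (MvPolynomial σv F) :=
  (m.support.toList.map
    (fun i => ((MvPolynomial.pderiv i).toLinearMap : Module.End F (MvPolynomial σv F)) ^ m i)).prod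

/-- `∂^k P` : the set of all partial derivatives of `P` of order `k`. -/
noncomputable def partialsSet {σv F : Type*} [CommRing F] (k : ℕ) (P : MvPolynomial σv F) :
    Set (MvPolynomial σv F) :=
  { g | ∃ m : σv →₀ ℕ, (m.sum fun _ e => e) = k ∧ g = iterDeriv m P }

/-- `x^ℓ · ∂^k P` : degree-`ℓ` monomial multiples of order-`k` partial derivatives of `P`. -/
noncomputable def shiftedPartialsSet {σv F : Type*} [CommRing F] (ℓ k : ℕ)
    (P : MvPolynomial σv F) : Set (MvPolynomial σv F) :=
  { q | ∃ m : σv →₀ ℕ, (m.sum fun _ e => e) = ℓ ∧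
      ∃ g ∈ partialsSet k P, q = MvPolynomial.monomial m (1 : F) * g }

/-- The shifted partials measure `SP_{k,ℓ}`. -/
noncomputable def SP {σv F : Type*} [Field F] (k ℓ : ℕ) (P : MvPolynomial σv F) : ℕ :=
  Module.finrank F (Submodule.span F (shiftedPartialsSet ℓ k P))

/-- The affine projections of partials measure `APP_{k,n₀}`. -/
noncomputable def APP {σv F : Type*} [Field F] (k n0 : ℕ) (P : MvPolynomial σv F) : ℕ :=
  sSup { r : ℕ | ∃ L : σv → MvPolynomial (Fin n0) F, (∀ i, (L i).IsHomogeneous 1) ∧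
    r = Module.finrank F (Submodule.span F
          ((fun g => MvPolynomial.aeval L g) '' partialsSet k P)) }

/-- `residue_k(d_1,…,d_t)`. -/
noncomputable def residue {t : ℕ} (k : ℕ) (ds : Fin t → ℕ) : ℝ :=
  (1 / 2) * sInf { r : ℝ | ∃ κ : Fin t → ℤ,
    r = ∑ i, |(κ i : ℝ) - ((k : ℝ) / ((∑ i, ds i : ℕ) : ℝ)) * (ds i : ℝ)| }

/-- `M(a,b) = C(a+b−1, b)`, the number of monic monomials of degree `b` in `a` variables. -/
def M (a b : ℕ) : ℕ := Nat.choose (a + b - 1) b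

/-- The Nisan–Wigderson design polynomial `NW_{q,d,k}`, where the finite field `F_q` is
represented by a finite field `K` (with `q = Fintype.card K`), the injection of `[d]` into
`F_q` is `ι`, and polynomials `h ∈ F_q[z]` of degree `< k` are parametrized by their
coefficient vectors `c : Fin k → K`. The variables are indexed by `Fin d × K`. -/
noncomputable def NW (K : Type*) [Field K] [Fintype K] (d k : ℕ) (ι : Fin d → K)
    (F : Type*) [Field F] : MvPolynomial (Fin d × K) F :=
  ∑ c : Fin k → K, ∏ i : Fin d, MvPolynomial.X (i, ∑ j : Fin k, c j * ι i ^ (j : ℕ))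

section Derivatives

variable {σ F : Type*} [DecidableEq σ]

theorem pderiv_prod_X [CommRing F] (a : σ) (V : Finset σ) :
    pderiv a (∏ x ∈ V, X x : MvPolynomial σ F) =
      if a ∈ V then ∏ x ∈ V.erase a, X x else 0 := by
  have hzero : ∀ W : Finset σ, a ∉ W → pderiv a (∏ x ∈ W, X x : MvPolynomial σ F) = 0 := by
    intro W
    induction W using Finset.induction_on with
    | empty => simp
    | insert b W hb ih =>
      intro ha
      rw [Finset.mem_insert, not_or] at ha
      rw [Finset.prod_insert hb, Derivation.leibniz, ih ha.2,
        pderiv_X_of_ne (Ne.symm ha.1), smul_zero, smul_zero, add_zero]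
  split_ifs with ha
  · rw [← Finset.mul_prod_erase V _ ha, Derivation.leibniz, hzero _ (Finset.notMem_erase a V),
      pderiv_X_self, smul_zero, zero_add, smul_eq_mul, mul_one]
  · exact hzero V ha

theorem list_pderiv_prod_X [CommRing F] (l : List σ) (hl : l.Nodup) (U : Finset σ) :
    (l.map fun i => ((pderiv i).toLinearMap : Module.End F (MvPolynomial σ F))).prod
        (∏ x ∈ U, X x) =
      if l.toFinset ⊆ U then ∏ x ∈ U \ l.toFinset, X x else 0 := by
  induction l with
  | nil => simp
  | cons a l ih =>
    rw [List.nodup_cons] at hl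
    rw [List.map_cons, List.prod_cons, Module.End.mul_apply, ih hl.2]
    by_cases h : l.toFinset ⊆ U
    · rw [if_pos h, Derivation.coeFn_coe, pderiv_prod_X]
      have hU : (U \ l.toFinset).erase a = U \ (a :: l).toFinset := by
        ext x
        simp only [Finset.mem_erase, Finset.mem_sdiff, List.toFinset_cons, Finset.mem_insert]
        tauto
      have hmem : a ∈ U \ l.toFinset ↔ (a :: l).toFinset ⊆ U := by
        simp [Finset.insert_subset_iff, hl.1, h]
      simp only [hmem, hU]
    · rw [if_neg h, map_zero, if_neg]
      intro h'
      rw [List.toFinset_cons] at h'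
      exact h ((Finset.subset_insert _ _).trans h')

theorem iterDeriv_indicator_prod_X [CommRing F] (T U : Finset σ) :
    iterDeriv (Finsupp.indicator T fun _ _ => 1) (∏ x ∈ U, X x : MvPolynomial σ F) =
      if T ⊆ U then ∏ x ∈ U \ T, X x else 0 := by
  have hsupp : (Finsupp.indicator T fun _ _ => 1 : σ →₀ ℕ).support = T := by
    ext x
    simp [Finsupp.indicator_apply]
  have h := list_pderiv_prod_X (F := F) T.toList T.nodup_toList U
  rw [Finset.toList_toFinset] at h
  rw [← h, iterDeriv, hsupp]
  congr 2
  refine List.map_congr_left fun x hx => ?_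
  rw [Finsupp.indicator_of_mem (Finset.mem_toList.1 hx), pow_one]

theorem linearIndependent_prod_X [CommRing F] :
    LinearIndependent F fun V : Finset σ => (∏ x ∈ V, X x : MvPolynomial σ F) := by
  have hinj : Function.Injective fun V : Finset σ =>
      (Finsupp.indicator V fun _ _ => 1 : σ →₀ ℕ) := by
    intro V W h
    ext x
    have hx := DFunLike.congr_fun h x
    simp only [Finsupp.indicator_apply] at hx
    by_cases hV : x ∈ V <;> by_cases hW : x ∈ W <;> simp_all
  have heq : (fun V : Finset σ => (∏ x ∈ V, X x : MvPolynomial σ F)) =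
      basisMonomials σ F ∘ fun V => Finsupp.indicator V fun _ _ => 1 := by
    ext1 V
    simp only [Function.comp_apply, coe_basisMonomials]
    rw [monomial_eq, Finsupp.prod_of_support_subset
      (s := V) _ (Finsupp.support_indicator_subset _ _) _ (by simp), C_1, one_mul]
    refine Finset.prod_congr rfl fun x hx => ?_
    rw [Finsupp.indicator_of_mem hx, pow_one]
  rw [heq]
  exact (basisMonomials σ F).linearIndependent.comp _ hinj

theorem finite_partialsSet [CommRing F] [Fintype σ] (k : ℕ) (P : MvPolynomial σ F) :
    (partialsSet k P).Finite := by
  refine ((Finset.univ.finsuppAntidiag k).finite_toSet.image fun m => iterDeriv m P).subset ?_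
  rintro _ ⟨m, hm, rfl⟩
  refine ⟨m, ?_, rfl⟩
  rw [Finset.mem_coe, Finset.mem_finsuppAntidiag]
  exact ⟨by rw [← hm, Finsupp.sum_fintype _ _ fun _ => rfl], Finset.subset_univ _⟩

end Derivatives

section Interpolation

variable {K : Type*} [Field K] {d k : ℕ}

/-- The part over `S` of the graph of the polynomial with coefficient vector `c`. -/
def graphOver [DecidableEq K] (ι : Fin d → K) (c : Fin k → K) (S : Finset (Fin d)) :
    Finset (Fin d × K) :=
  S.image fun i => (i, ∑ j : Fin k, c j * ι i ^ (j : ℕ))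

theorem coeff_eq_of_agree {ι : Fin d → K} (hι : Function.Injective ι) {S : Finset (Fin d)}
    (hS : k ≤ S.card) {c c' : Fin k → K}
    (h : ∀ i ∈ S, ∑ j : Fin k, c j * ι i ^ (j : ℕ) = ∑ j : Fin k, c' j * ι i ^ (j : ℕ)) :
    c = c' := by
  rw [← sub_eq_zero]
  refine Matrix.eq_zero_of_forall_index_sum_mul_pow_eq_zero
    (hι.comp (S.orderEmbOfCardLe hS).injective) fun i => ?_
  simp only [Pi.sub_apply, sub_mul, Finset.sum_sub_distrib]
  exact sub_eq_zero.2 (h _ (S.orderEmbOfCardLe_mem hS i))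

variable [DecidableEq K]

theorem mem_graphOver {ι : Fin d → K} {c : Fin k → K} {S : Finset (Fin d)} {x : Fin d × K} :
    x ∈ graphOver ι c S ↔ x.1 ∈ S ∧ x.2 = ∑ j : Fin k, c j * ι x.1 ^ (j : ℕ) := by
  rcases x with ⟨i, y⟩
  simp only [graphOver, Finset.mem_image, Prod.mk.injEq]
  constructor
  · rintro ⟨i, hi, rfl, rfl⟩
    exact ⟨hi, rfl⟩
  · rintro ⟨hi, rfl⟩
    exact ⟨i, hi, rfl, rfl⟩

theorem card_graphOver (ι : Fin d → K) (c : Fin k → K) (S : Finset (Fin d)) :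
    (graphOver ι c S).card = S.card :=
  Finset.card_image_of_injective _ fun _ _ h => congrArg Prod.fst h

theorem prod_graphOver {N : Type*} [CommMonoid N] (ι : Fin d → K) (c : Fin k → K)
    (S : Finset (Fin d)) (f : Fin d × K → N) :
    ∏ x ∈ graphOver ι c S, f x = ∏ i ∈ S, f (i, ∑ j : Fin k, c j * ι i ^ (j : ℕ)) :=
  Finset.prod_image fun _ _ _ _ h => congrArg Prod.fst h

theorem graphOver_subset_univ_iff {ι : Fin d → K} (hι : Function.Injective ι)
    {S : Finset (Fin d)} (hS : k ≤ S.card) {c c' : Fin k → K} :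
    graphOver ι c S ⊆ graphOver ι c' Finset.univ ↔ c = c' := by
  constructor
  · exact fun h => coeff_eq_of_agree hι hS fun i hi =>
      (mem_graphOver.1 (h (mem_graphOver.2 ⟨hi, rfl⟩ : (i, _) ∈ graphOver ι c S))).2
  · rintro rfl
    exact Finset.image_subset_image (Finset.subset_univ S)

theorem graphOver_univ_sdiff (ι : Fin d → K) (c : Fin k → K) (S : Finset (Fin d)) :
    graphOver ι c Finset.univ \ graphOver ι c S = graphOver ι c Sᶜ := by
  ext x
  simp only [Finset.mem_sdiff, mem_graphOver, Finset.mem_univ, Finset.mem_compl]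
  tauto

theorem graphOver_injective {ι : Fin d → K} (hι : Function.Injective ι)
    {S S' : Finset (Fin d)} (hS : k ≤ S.card) {c c' : Fin k → K}
    (h : graphOver ι c S = graphOver ι c' S') : S = S' ∧ c = c' := by
  have himage : ∀ (c : Fin k → K) (S : Finset (Fin d)),
      (graphOver ι c S).image Prod.fst = S := by
    intro c S
    rw [graphOver, Finset.image_image]
    exact Finset.image_id
  refine ⟨by rw [← himage c S, h, himage], (graphOver_subset_univ_iff hι hS).1 ?_⟩
  rw [h]
  exact Finset.image_subset_image (Finset.subset_univ S')

theorem iterDeriv_NW [Fintype K] {ι : Fin d → K} (hι : Function.Injective ι) (F : Type*)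
    [Field F] {S : Finset (Fin d)} (hS : k ≤ S.card) (c : Fin k → K) :
    iterDeriv (Finsupp.indicator (graphOver ι c S) fun _ _ => 1) (NW K d k ι F) =
      ∏ x ∈ graphOver ι c Sᶜ, X x := by
  simp_rw [NW, map_sum, ← prod_graphOver ι _ Finset.univ (X : _ → MvPolynomial (Fin d × K) F),
    iterDeriv_indicator_prod_X, graphOver_subset_univ_iff hι hS]
  rw [Finset.sum_ite_eq, if_pos (Finset.mem_univ c), graphOver_univ_sdiff]

end Interpolation

/-- the `k`-th order partial derivatives of `NW_{q,d,k}` span a space of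
dimension at least `C(d,k)·q^k`. -/
theorem stmt12 (K : Type*) [Field K] [Fintype K] (d k : ℕ) (hk : 0 < k)
    (hdq : d ≤ Fintype.card K) (h2k : 2 * k + 1 ≤ d)
    (ι : Fin d → K) (hι : Function.Injective ι)
    (F : Type*) [Field F] :
    Nat.choose d k * Fintype.card K ^ k ≤
      Module.finrank F (Submodule.span F (partialsSet k (NW K d k ι F))) := by
  classical
  have : Module.Finite F (Submodule.span F (partialsSet k (NW K d k ι F))) :=
    Module.Finite.span_of_finite F (finite_partialsSet k _)
  let B := {S : Finset (Fin d) // S ∈ Finset.powersetCard k Finset.univ} × (Fin k → K)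
  have hcard (b : B) : b.1.1.card = k := (Finset.mem_powersetCard.1 b.1.2).2
  have hcompl (b : B) : k ≤ (b.1.1ᶜ).card := by
    rw [Finset.card_compl, hcard, Fintype.card_fin]
    omega
  have hinj : Function.Injective fun b : B => graphOver ι b.2 b.1.1ᶜ := by
    intro b b' h
    obtain ⟨hS, hc⟩ := graphOver_injective hι (hcompl b) h
    exact Prod.ext (Subtype.ext (compl_injective hS)) hc
  have hli := (linearIndependent_prod_X (F := F)).comp _ hinj
  have hmem (b : B) : (∏ x ∈ graphOver ι b.2 b.1.1ᶜ, X x : MvPolynomial (Fin d × K) F) ∈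
      Submodule.span F (partialsSet k (NW K d k ι F)) := by
    refine Submodule.subset_span ⟨_, ?_, (iterDeriv_NW hι F (hcard b).ge b.2).symm⟩
    rw [Finsupp.sum_of_support_subset _ (Finsupp.support_indicator_subset _ _) _ (by simp),
      Finset.sum_congr rfl fun x hx => Finsupp.indicator_of_mem hx _, Finset.sum_const,
      card_graphOver, hcard, smul_eq_mul, mul_one]
  have hle := (LinearIndependent.of_comp (Submodule.subtype _)
    (v := fun b => (⟨_, hmem b⟩ : Submodule.span F (partialsSet k (NW K d k ι F))))
    hli).fintype_card_le_finrank
  simpa [B] using hle
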